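/- arXiv:2404.13952 — 2 statements merged into one kernel-verified Lean document; each statement's English description precedes it below -/
import Mathlib

section
/- The four lattices L₁ = {(x,y) ∈ ℤ² : y ≡ 0 (mod 3)}, L₂ = {(x,y) ∈ ℤ² : x ≡ 0 (mod 3)}, L₃ = {(x,y) ∈ ℤ² : x ≡ y (mod 3)}, and L₄ = {(x,y) ∈ ℤ² : y ≡ 2x (mod 3)} (generated respectively by (1,0),(0,3); (3,0),(0,1); (1,1),(0,3); and (1,2),(0,3)) form a minimal covering of ℤ². -/
/-- The sublattice of ℤ² defined by the congruence `a·x₁ + b·x₂ ≡ 0 (mod n)`. -/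
def congLat (a b n : ℤ) : AddSubgroup (ℤ × ℤ) where
  carrier := {p : ℤ × ℤ | n ∣ a * p.1 + b * p.2}
  zero_mem' := by simp
  add_mem' := by
    intro p q hp hq
    simp only [Set.mem_setOf_eq, Prod.fst_add, Prod.snd_add] at *
    have e : a * (p.1 + q.1) + b * (p.2 + q.2)
        = (a * p.1 + b * p.2) + (a * q.1 + b * q.2) := by ring
    rw [e]; exact dvd_add hp hq
  neg_mem' := by
    intro p hp
    simp only [Set.mem_setOf_eq, Prod.fst_neg, Prod.snd_neg] at *
    have e : a * (-p.1) + b * (-p.2) = -(a * p.1 + b * p.2) := by ring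
    rw [e]; exact hp.neg_right

/-- A lattice: a finite-index (equivalently, rank-2) subgroup of ℤ². -/
def IsLattice (L : AddSubgroup (ℤ × ℤ)) : Prop := L.index ≠ 0

/-- A finite family of lattices covering ℤ². -/
def IsCovering {k : ℕ} (L : Fin k → AddSubgroup (ℤ × ℤ)) : Prop :=
  (∀ i, IsLattice (L i)) ∧ ∀ p : ℤ × ℤ, ∃ i, p ∈ L i

/-- A minimal covering of ℤ² by lattices: replacing any member by a proper
sublattice destroys the covering property. -/
def IsMinimalCovering {k : ℕ} (L : Fin k → AddSubgroup (ℤ × ℤ)) : Prop :=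
  IsCovering L ∧ ∀ (i : Fin k) (L' : AddSubgroup (ℤ × ℤ)),
    IsLattice L' → L' < L i → ¬ IsCovering (Function.update L i L')

theorem mem_congLat_iff (a b n : ℤ) (p : ℤ × ℤ) :
    p ∈ congLat a b n ↔ n ∣ a * p.1 + b * p.2 := Iff.rfl

theorem isLattice_congLat (a b : ℤ) : IsLattice (congLat a b 3) := by
  let f : ℤ × ℤ →+ ZMod 3 :=
    { toFun := fun p => ((a * p.1 + b * p.2 : ℤ) : ZMod 3)
      map_zero' := by simp
      map_add' := by intro p q; push_cast [Prod.fst_add, Prod.snd_add]; ring }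
  have hf : congLat a b 3 = f.ker := by
    ext p
    rw [mem_congLat_iff, AddMonoidHom.mem_ker]
    exact (ZMod.intCast_zmod_eq_zero_iff_dvd _ 3).symm
  unfold IsLattice
  rw [hf, AddSubgroup.index_ker]
  exact ne_of_gt Nat.card_pos

/-- A subgroup containing all points of L outside 3ℤ² contains L, if there is such a point. -/
theorem le_of_outside (L L' : AddSubgroup (ℤ × ℤ)) (v : ℤ × ℤ) (hv : v ∈ L)
    (hv3 : ¬ (3 ∣ v.1 ∧ 3 ∣ v.2))
    (h : ∀ p ∈ L, ¬ (3 ∣ p.1 ∧ 3 ∣ p.2) → p ∈ L') : L ≤ L' := by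
  intro q hq
  by_cases h3 : 3 ∣ q.1 ∧ 3 ∣ q.2
  · have h1 : q - v ∈ L' := by
      apply h _ (L.sub_mem hq hv)
      simp only [Prod.fst_sub, Prod.snd_sub]
      omega
    have h2 := L'.add_mem h1 (h v hv hv3)
    simpa using h2
  · exact h q hq h3

/-- The four lattices `{y ≡ 0 (3)}`, `{x ≡ 0 (3)}`, `{x ≡ y (3)}`, `{y ≡ 2x (3)}`
form a minimal covering of ℤ². -/
theorem minimal_covering_stmt :
    IsMinimalCovering ![congLat 0 1 3, congLat 1 0 3, congLat 1 (-1) 3, congLat (-2) 1 3] := by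
  refine ⟨⟨?_, ?_⟩, ?_⟩
  · intro i
    fin_cases i <;> exact isLattice_congLat _ _
  · intro p
    simp [Fin.exists_fin_succ, mem_congLat_iff]
    have h1 : p.1 % 3 = 0 ∨ p.1 % 3 = 1 ∨ p.1 % 3 = 2 := by omega
    have h2 : p.2 % 3 = 0 ∨ p.2 % 3 = 1 ∨ p.2 % 3 = 2 := by omega
    rcases h1 with h1 | h1 | h1 <;> rcases h2 with h2 | h2 | h2 <;> omega
  · intro i L' _ hlt hcov
    refine hlt.not_ge ?_
    have hc := hcov.2
    fin_cases i
    · refine le_of_outside _ _ (1, 0) ?_ (by norm_num) ?_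
      · simp [mem_congLat_iff]
      · intro p hp h3
        obtain ⟨j, hj⟩ := hc p
        fin_cases j <;> simp [Function.update, mem_congLat_iff] at hj hp ⊢ <;>
          first | exact hj | omega
    · refine le_of_outside _ _ (0, 1) ?_ (by norm_num) ?_
      · simp [mem_congLat_iff]
      · intro p hp h3
        obtain ⟨j, hj⟩ := hc p
        fin_cases j <;> simp [Function.update, mem_congLat_iff] at hj hp ⊢ <;>
          first | exact hj | omega
    · refine le_of_outside _ _ (1, 1) ?_ (by norm_num) ?_
      · simp [mem_congLat_iff]
      · intro p hp h3
        obtain ⟨j, hj⟩ := hc p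
        fin_cases j <;> simp [Function.update, mem_congLat_iff] at hj hp ⊢ <;>
          first | exact hj | omega
    · refine le_of_outside _ _ (1, 2) ?_ (by norm_num) ?_
      · simp [mem_congLat_iff]
      · intro p hp h3
        obtain ⟨j, hj⟩ := hc p
        fin_cases j <;> simp [Function.update, mem_congLat_iff] at hj hp ⊢ <;>
          first | exact hj | omega
end

section
/- Let (D,ν) ∈ {(2,2),(2,4),(4,8)} and let t₁,t₂,t₃,t₄ be integers with gcd(t₁,t₂,t₃,t₄) = 1 and d₂ := |t₁t₄ − t₂t₃| ≠ 0. Define the four subgroups of ℤ²: Λ₀ := {(x₁,x₂) : x₁ ≡ 0 (mod D) and νx₂ ≡ 0 (mod D)}; Λ₁ := {(x₁,x₂) : (t₁t₂+t₃t₄)x₁ + (t₂²+t₄²)x₂ ≡ 0 (mod d₂D) and ν((t₁²+t₃²)x₁ + (t₁t₂+t₃t₄)x₂) ≡ 0 (mod d₂D)}; Λ₂ := {(x₁,x₂) : (t₃t₄−t₁t₂)x₁ + (t₄²−t₂²)x₂ ≡ 0 (mod d₂D) and ν((t₁²−t₃²)x₁ + (t₁t₂−t₃t₄)x₂) ≡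 0 (mod d₂D)}; Λ₃ := {(x₁,x₂) : (t₂t₃+t₁t₄)x₁ + 2t₂t₄x₂ ≡ 0 (mod d₂D) and ν(2t₁t₃x₁ + (t₂t₃+t₁t₄)x₂) ≡ 0 (mod d₂D)}. If Λ₀ ∪ Λ₁ ∪ Λ₂ ∪ Λ₃ = ℤ² and Λᵢ ≠ ℤ² for all i ∈ {0,1,2,3}, then no odd prime divides d₂; that is, d₂ is a power of 2. -/
/-- `Λ₀ = {(x₁,x₂) : x₁ ≡ 0 (mod D), ν·x₂ ≡ 0 (mod D)}`. -/
def Lam0 (D ν : ℤ) : AddSubgroup (ℤ × ℤ) := congLat 1 0 D ⊓ congLat 0 ν D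

/-- `Λ₁`, cut out by `(t₁t₂+t₃t₄)x₁ + (t₂²+t₄²)x₂ ≡ 0` and
`ν((t₁²+t₃²)x₁ + (t₁t₂+t₃t₄)x₂) ≡ 0 (mod d₂D)`, where `d₂ = |t₁t₄ - t₂t₃|`. -/
def Lam1 (D ν t1 t2 t3 t4 : ℤ) : AddSubgroup (ℤ × ℤ) :=
  congLat (t1 * t2 + t3 * t4) (t2 ^ 2 + t4 ^ 2) (|t1 * t4 - t2 * t3| * D) ⊓
    congLat (ν * (t1 ^ 2 + t3 ^ 2)) (ν * (t1 * t2 + t3 * t4)) (|t1 * t4 - t2 * t3| * D)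

/-- `Λ₂`, cut out by `(t₃t₄-t₁t₂)x₁ + (t₄²-t₂²)x₂ ≡ 0` and
`ν((t₁²-t₃²)x₁ + (t₁t₂-t₃t₄)x₂) ≡ 0 (mod d₂D)`. -/
def Lam2 (D ν t1 t2 t3 t4 : ℤ) : AddSubgroup (ℤ × ℤ) :=
  congLat (t3 * t4 - t1 * t2) (t4 ^ 2 - t2 ^ 2) (|t1 * t4 - t2 * t3| * D) ⊓
    congLat (ν * (t1 ^ 2 - t3 ^ 2)) (ν * (t1 * t2 - t3 * t4)) (|t1 * t4 - t2 * t3| * D)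

/-- `Λ₃`, cut out by `(t₂t₃+t₁t₄)x₁ + 2t₂t₄x₂ ≡ 0` and
`ν(2t₁t₃x₁ + (t₂t₃+t₁t₄)x₂) ≡ 0 (mod d₂D)`. -/
def Lam3 (D ν t1 t2 t3 t4 : ℤ) : AddSubgroup (ℤ × ℤ) :=
  congLat (t2 * t3 + t1 * t4) (2 * t2 * t4) (|t1 * t4 - t2 * t3| * D) ⊓
    congLat (ν * (2 * t1 * t3)) (ν * (t2 * t3 + t1 * t4)) (|t1 * t4 - t2 * t3| * D)


theorem three_cover {G : Type*} [AddCommGroup G] (H K L : AddSubgroup G)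
    (hH : H ≠ ⊤) (hK : K ≠ ⊤) (hL : L ≠ ⊤) (h2 : ∀ x, x + x ∈ L → x ∈ L)
    (hc : ∀ x, x ∈ H ∨ x ∈ K ∨ x ∈ L) : False := by
  -- a covering by two proper subgroups is impossible
  have two : ∀ A B : AddSubgroup G, A ≠ ⊤ → B ≠ ⊤ → ∃ x, x ∉ A ∧ x ∉ B := by
    intro A B hA hB
    by_contra! hcon
    obtain ⟨a, ha⟩ : ∃ a, a ∉ A := by
      by_contra! h
      exact hA ((AddSubgroup.eq_top_iff' A).2 h)
    obtain ⟨b, hb⟩ : ∃ b, b ∉ B := by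
      by_contra! h
      exact hB ((AddSubgroup.eq_top_iff' B).2 h)
    have haB := hcon a ha
    have hbA : b ∈ A := by
      by_contra h
      exact hb (hcon b h)
    by_cases hs : a + b ∈ A
    · exact ha ((AddSubgroup.add_mem_cancel_right A hbA).1 hs)
    · exact hb ((AddSubgroup.add_mem_cancel_left B haB).1 (hcon _ hs))
  obtain ⟨g, gH, gK⟩ := two H K hH hK
  have gL : g ∈ L := by
    rcases hc g with h | h | h
    · exact absurd h gH
    · exact absurd h gK
    · exact h
  obtain ⟨h, hh⟩ : ∃ a, a ∉ L := by
    by_contra! h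
    exact hL ((AddSubgroup.eq_top_iff' L).2 h)
  have hg : h + g ∉ L := fun h' => hh ((AddSubgroup.add_mem_cancel_right L gL).1 h')
  have hhg : h + (h + g) ∉ L := by
    intro h'
    rw [← add_assoc] at h'
    exact hh (h2 _ ((AddSubgroup.add_mem_cancel_right L gL).1 h'))
  have aux : ∀ A B : AddSubgroup G, g ∉ A → g ∉ B → (∀ x, x ∉ L → x ∈ A ∨ x ∈ B) →
      h ∈ A → False := by
    intro A B gA gB hAB hA
    have hgA : h + g ∉ A := fun h' => gA ((AddSubgroup.add_mem_cancel_left A hA).1 h')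
    have hgB : h + g ∈ B := (hAB _ hg).resolve_left hgA
    rcases hAB _ hhg with h' | h'
    · exact hgA ((AddSubgroup.add_mem_cancel_left A hA).1 h')
    · have hB : h ∈ B := (AddSubgroup.add_mem_cancel_right B hgB).1 h'
      exact gB ((AddSubgroup.add_mem_cancel_left B hB).1 hgB)
  have hc' : ∀ x, x ∉ L → x ∈ H ∨ x ∈ K := by
    intro x hx
    have := hc x
    tauto
  rcases hc' h hh with h' | h'
  · exact aux H K gH gK hc' h'
  · exact aux K H gK gH (fun x hx => (hc' x hx).symm) h'

theorem rank_one {F : Type*} [Field F] (t1 t2 t3 t4 : F) (hdet : t1 * t4 - t2 * t3 = 0) :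
    ∃ a b c e : F, t1 = a * c ∧ t2 = a * e ∧ t3 = b * c ∧ t4 = b * e := by
  by_cases h1 : t1 = 0
  · by_cases h2 : t2 = 0
    · exact ⟨0, 1, t3, t4, by simp [h1], by simp [h2], by simp, by simp⟩
    · refine ⟨1, t4 / t2, t1, t2, by simp, by simp, ?_, by field_simp⟩
      field_simp
      linear_combination -hdet
  · refine ⟨1, t3 / t1, t1, t2, by simp, by simp, by field_simp, ?_⟩
    field_simp
    linear_combination hdet

theorem field_key {F : Type*} [Field F] (h2 : (2 : F) ≠ 0) (t1 t2 t3 t4 : F)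
    (hdet : t1 * t4 - t2 * t3 = 0) (hne : ¬ (t1 = 0 ∧ t2 = 0 ∧ t3 = 0 ∧ t4 = 0)) :
    ∃ q1 q2 q3 : Prop, ((¬ q1 ∧ ¬ q2) ∨ (¬ q1 ∧ ¬ q3) ∨ (¬ q2 ∧ ¬ q3)) ∧
    (∀ x y : F, (t1 * t2 + t3 * t4) * x + (t2 ^ 2 + t4 ^ 2) * y = 0 →
      (t1 ^ 2 + t3 ^ 2) * x + (t1 * t2 + t3 * t4) * y = 0 →
      ¬ q1 → t1 * x + t2 * y = 0 ∧ t3 * x + t4 * y = 0) ∧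
    (∀ x y : F, (t3 * t4 - t1 * t2) * x + (t4 ^ 2 - t2 ^ 2) * y = 0 →
      (t1 ^ 2 - t3 ^ 2) * x + (t1 * t2 - t3 * t4) * y = 0 →
      ¬ q2 → t1 * x + t2 * y = 0 ∧ t3 * x + t4 * y = 0) ∧
    (∀ x y : F, (t2 * t3 + t1 * t4) * x + (2 * t2 * t4) * y = 0 →
      (2 * t1 * t3) * x + (t2 * t3 + t1 * t4) * y = 0 →
      ¬ q3 → t1 * x + t2 * y = 0 ∧ t3 * x + t4 * y = 0) := by
  obtain ⟨a, b, c, e, rfl, rfl, rfl, rfl⟩ := rank_one t1 t2 t3 t4 hdet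
  have hab : ¬ (a = 0 ∧ b = 0) := by
    rintro ⟨rfl, rfl⟩
    simp at hne
  have hce : ¬ (c = 0 ∧ e = 0) := by
    rintro ⟨rfl, rfl⟩
    simp at hne
  -- general cancellation step
  have canc : ∀ q x y : F, q * e * (c * x + e * y) = 0 → q * c * (c * x + e * y) = 0 → ¬ q = 0 →
      a * c * x + a * e * y = 0 ∧ b * c * x + b * e * y = 0 := by
    intro q x y h h' hq
    have hl : c * x + e * y = 0 := by
      by_contra hl
      simp only [mul_eq_zero, hq, hl, or_false, false_or] at h h'
      exact hce ⟨h', h⟩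
    constructor
    · linear_combination a * hl
    · linear_combination b * hl
  refine ⟨a ^ 2 + b ^ 2 = 0, b ^ 2 - a ^ 2 = 0, 2 * a * b = 0, ?_, ?_, ?_, ?_⟩
  · have key12 : a ^ 2 + b ^ 2 = 0 → b ^ 2 - a ^ 2 = 0 → False := by
      intro h h'
      have hb : 2 * b ^ 2 = 0 := by linear_combination h + h'
      have ha : 2 * a ^ 2 = 0 := by linear_combination h - h'
      simp [h2] at ha hb
      exact hab ⟨ha, hb⟩
    have key13 : a ^ 2 + b ^ 2 = 0 → 2 * a * b = 0 → False := by
      intro h h'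
      simp only [mul_eq_zero, h2, false_or] at h'
      rcases h' with rfl | rfl <;> simp_all
    have key23 : b ^ 2 - a ^ 2 = 0 → 2 * a * b = 0 → False := by
      intro h h'
      simp only [mul_eq_zero, h2, false_or] at h'
      rcases h' with rfl | rfl <;> simp_all
    tauto
  · intro x y h h'
    exact canc _ x y (by linear_combination h) (by linear_combination h')
  · intro x y h h'
    exact canc _ x y (by linear_combination h) (by linear_combination -h')
  · intro x y h h'
    exact canc _ x y (by linear_combination h) (by linear_combination h')

theorem mem_congLat (a b n : ℤ) (x : ℤ × ℤ) : x ∈ congLat a b n ↔ n ∣ a * x.1 + b * x.2 :=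
  Iff.rfl

/-- If `(D,ν) ∈ {(2,2),(2,4),(4,8)}` and the four lattices `Λ₀, Λ₁, Λ₂, Λ₃` cover
ℤ² with none of them equal to ℤ², then `d₂ = |t₁t₄ - t₂t₃|` is a power of 2. -/
theorem lattice_covering_stmt (D ν t1 t2 t3 t4 : ℤ)
    (hDν : (D, ν) = (2, 2) ∨ (D, ν) = (2, 4) ∨ (D, ν) = (4, 8))
    (hgcd : Int.gcd (Int.gcd (Int.gcd t1 t2) t3) t4 = 1)
    (hd2 : t1 * t4 - t2 * t3 ≠ 0)
    (hcover : ∀ p : ℤ × ℤ, p ∈ Lam0 D ν ∨ p ∈ Lam1 D ν t1 t2 t3 t4 ∨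
      p ∈ Lam2 D ν t1 t2 t3 t4 ∨ p ∈ Lam3 D ν t1 t2 t3 t4)
    (hproper : Lam0 D ν ≠ ⊤ ∧ Lam1 D ν t1 t2 t3 t4 ≠ ⊤ ∧
      Lam2 D ν t1 t2 t3 t4 ≠ ⊤ ∧ Lam3 D ν t1 t2 t3 t4 ≠ ⊤) :
    ∃ k : ℕ, |t1 * t4 - t2 * t3| = 2 ^ k := by
  have hdiv : ∀ p : ℕ, p.Prime → p ∣ (t1 * t4 - t2 * t3).natAbs → ¬ Odd p := by
    intro p hp hpd hodd
    haveI : Fact p.Prime := ⟨hp⟩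
    have hpd' : (p : ℤ) ∣ t1 * t4 - t2 * t3 := Int.natCast_dvd.2 hpd
    have hmod : (p : ℤ) ∣ |t1 * t4 - t2 * t3| * D := ((dvd_abs _ _).2 hpd').mul_right _
    have z : ∀ n : ℤ, (n : ZMod p) = 0 ↔ (p : ℤ) ∣ n := fun n => ZMod.intCast_zmod_eq_zero_iff_dvd n p
    have h2 : (2 : ZMod p) ≠ 0 := by
      intro h
      have h' : ((2 : ℕ) : ZMod p) = 0 := by exact_mod_cast h
      rw [ZMod.natCast_eq_zero_iff, Nat.prime_dvd_prime_iff_eq hp Nat.prime_two] at h'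
      subst h'
      exact absurd hodd (by decide)
    have hν : (ν : ZMod p) ≠ 0 := by
      have h4 : (4 : ZMod p) ≠ 0 := by
        have : (4 : ZMod p) = 2 ^ 2 := by norm_num
        rw [this]; exact pow_ne_zero _ h2
      have h8 : (8 : ZMod p) ≠ 0 := by
        have : (8 : ZMod p) = 2 ^ 3 := by norm_num
        rw [this]; exact pow_ne_zero _ h2
      simp only [Prod.mk.injEq] at hDν
      rcases hDν with ⟨-, rfl⟩ | ⟨-, rfl⟩ | ⟨-, rfl⟩
      · exact_mod_cast h2
      · exact_mod_cast h4
      · exact_mod_cast h8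
    have hdet : (t1 : ZMod p) * t4 - t2 * t3 = 0 := by exact_mod_cast (z _).2 hpd'
    have hne : ¬ ((t1 : ZMod p) = 0 ∧ (t2 : ZMod p) = 0 ∧ (t3 : ZMod p) = 0 ∧ (t4 : ZMod p) = 0) := by
      rintro ⟨a1, a2, a3, a4⟩
      rw [z] at a1 a2 a3 a4
      have := Int.dvd_coe_gcd (Int.dvd_coe_gcd (Int.dvd_coe_gcd a1 a2) a3) a4
      rw [hgcd] at this
      exact hp.one_lt.ne' (Nat.dvd_one.1 (by exact_mod_cast this))
    obtain ⟨q1, q2, q3, hq, k1, k2, k3⟩ := field_key h2 (t1 : ZMod p) t2 t3 t4 hdet hne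
    -- the sublattice of points killed by `T` modulo `p`
    let L : AddSubgroup (ℤ × ℤ) := congLat t1 t2 p ⊓ congLat t3 t4 p
    have memL : ∀ x : ℤ × ℤ, x ∈ L ↔ (t1 : ZMod p) * x.1 + t2 * x.2 = 0 ∧
        (t3 : ZMod p) * x.1 + t4 * x.2 = 0 := by
      intro x
      rw [AddSubgroup.mem_inf, mem_congLat, mem_congLat, ← z, ← z]
      push_cast
      rfl
    have red : ∀ n : ℤ, |t1 * t4 - t2 * t3| * D ∣ n → (n : ZMod p) = 0 :=
      fun n h => (z n).2 (hmod.trans h)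
    have s1 : ¬ q1 → ∀ x ∈ Lam1 D ν t1 t2 t3 t4, x ∈ L := by
      rintro hq ⟨x, y⟩ ⟨ha, hb⟩
      have ha' := red _ ha
      have hb' := red _ hb
      push_cast at ha' hb'
      refine (memL _).2 (k1 _ _ ha' (mul_left_cancel₀ hν ?_) hq)
      linear_combination hb'
    have s2 : ¬ q2 → ∀ x ∈ Lam2 D ν t1 t2 t3 t4, x ∈ L := by
      rintro hq ⟨x, y⟩ ⟨ha, hb⟩
      have ha' := red _ ha
      have hb' := red _ hb
      push_cast at ha' hb'
      refine (memL _).2 (k2 _ _ ha' (mul_left_cancel₀ hν ?_) hq)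
      linear_combination hb'
    have s3 : ¬ q3 → ∀ x ∈ Lam3 D ν t1 t2 t3 t4, x ∈ L := by
      rintro hq ⟨x, y⟩ ⟨ha, hb⟩
      have ha' := red _ ha
      have hb' := red _ hb
      push_cast at ha' hb'
      refine (memL _).2 (k3 _ _ ha' (mul_left_cancel₀ hν ?_) hq)
      linear_combination hb'
    have hLtop : L ≠ ⊤ := by
      intro h
      have e1 := (memL (1, 0)).1 (h ▸ AddSubgroup.mem_top _)
      have e2 := (memL (0, 1)).1 (h ▸ AddSubgroup.mem_top _)
      simp at e1 e2
      exact hne ⟨e1.1, e2.1, e1.2, e2.2⟩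
    have hL2 : ∀ x, x + x ∈ L → x ∈ L := by
      intro x hx
      rw [memL] at hx ⊢
      simp only [Prod.fst_add, Prod.snd_add] at hx
      push_cast at hx
      constructor
      · exact mul_left_cancel₀ h2 (by linear_combination hx.1)
      · exact mul_left_cancel₀ h2 (by linear_combination hx.2)
    obtain ⟨p0, p1, p2, p3⟩ := hproper
    rcases hq with ⟨a, b⟩ | ⟨a, b⟩ | ⟨a, b⟩
    · refine three_cover _ _ L p0 p3 hLtop hL2 fun x => ?_
      rcases hcover x with h | h | h | h
      · exact Or.inl h
      · exact Or.inr (Or.inr (s1 a x h))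
      · exact Or.inr (Or.inr (s2 b x h))
      · exact Or.inr (Or.inl h)
    · refine three_cover _ _ L p0 p2 hLtop hL2 fun x => ?_
      rcases hcover x with h | h | h | h
      · exact Or.inl h
      · exact Or.inr (Or.inr (s1 a x h))
      · exact Or.inr (Or.inl h)
      · exact Or.inr (Or.inr (s3 b x h))
    · refine three_cover _ _ L p0 p1 hLtop hL2 fun x => ?_
      rcases hcover x with h | h | h | h
      · exact Or.inl h
      · exact Or.inr (Or.inl h)
      · exact Or.inr (Or.inr (s2 a x h))
      · exact Or.inr (Or.inr (s3 b x h))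
  rcases Nat.eq_two_pow_or_exists_odd_prime_and_dvd (t1 * t4 - t2 * t3).natAbs with ⟨k, hk⟩ | ⟨p, hp, hpd, ho⟩
  · refine ⟨k, ?_⟩
    rw [Int.abs_eq_natAbs, hk]
    push_cast
    rfl
  · exact absurd ho (hdiv p hp hpd)
end
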